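/- arXiv:1107.2631 — 2 statements merged into one kernel-verified Lean document; each statement's English description precedes it below -/
import Mathlib

section
/- (Ringel) Let A be an abelian length category and X ⊂ Y a Gabriel-Roiter inclusion between indecomposable objects. Then the quotient Y/X is indecomposable. -/
open CategoryTheory CategoryTheory.Limits

/-- The lexicographic order on finite subsets of ℕ:
`X ≤ Y` iff `min (Y \ X) ≤ min (X \ Y)`, with `min ∅ = ⊤`. -/
def lexLE (X Y : Finset ℕ) : Prop :=
  (Y \ X).min ≤ (X \ Y).min

/-- Strict lexicographic order. -/
def lexLT (X Y : Finset ℕ) : Prop :=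
  lexLE X Y ∧ ¬ lexLE Y X

variable {C : Type*} [Category C] [Abelian C]

/-- `n` is the composition length of the object `X`: there is a maximal
strictly increasing chain of subobjects of `X` from `⊥` to `⊤` with `n`
steps, and every strictly increasing chain of subobjects has at most
`n` steps. -/
def ObjLength (X : C) (n : ℕ) : Prop :=
  (∃ f : Fin (n + 1) → Subobject X, StrictMono f ∧ f 0 = ⊥ ∧ f (Fin.last n) = ⊤) ∧
  ∀ (m : ℕ) (f : Fin (m + 1) → Subobject X), StrictMono f → m ≤ n

/-- `A` is the set of lengths of a finite chain of indecomposable subobjects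
of `X` ending in `X` itself. -/
def IsGRChainVal (len : C → ℕ) (X : C) (A : Finset ℕ) : Prop :=
  ∃ s : Finset (Subobject X),
    IsChain (· ≤ ·) (s : Set (Subobject X)) ∧
    (⊤ : Subobject X) ∈ s ∧
    (∀ t ∈ s, Indecomposable ((t : Subobject X) : C)) ∧
    s.image (fun t : Subobject X => len ((t : Subobject X) : C)) = A

/-- `mu` is the Gabriel-Roiter measure associated to the length function
`len`: for each indecomposable `X`, `mu X` is the lexicographic maximum of
the sets of lengths along chains of indecomposable subobjects of `X`. -/
def IsGRMeasure (len : C → ℕ) (mu : C → Finset ℕ) : Prop :=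
  ∀ X : C, Indecomposable X →
    IsGRChainVal len X (mu X) ∧
    ∀ A : Finset ℕ, IsGRChainVal len X A → lexLE A (mu X)

/-- `X` is a Gabriel-Roiter predecessor of `Y`: both are indecomposable,
`X` is a proper subobject of `Y`, and `mu X` attains the maximum of the
Gabriel-Roiter measures of the proper indecomposable subobjects of `Y`. -/
def IsGRPred (mu : C → Finset ℕ) (X Y : C) : Prop :=
  Indecomposable X ∧ Indecomposable Y ∧
  (∃ f : X ⟶ Y, Mono f ∧ ¬ IsIso f) ∧
  ∀ t : Subobject Y, t ≠ ⊤ → Indecomposable ((t : Subobject Y) : C) →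
    lexLE (mu ((t : Subobject Y) : C)) (mu X)


/-! ### The lexicographic order -/

/-- The characteristic function of a finite set, in the lexicographic order. -/
noncomputable def grChi (A : Finset ℕ) : Lex (ℕ → Bool) := toLex (fun n => decide (n ∈ A))

theorem lexLE_iff_forall (A B : Finset ℕ) :
    lexLE A B ↔ ∀ x ∈ A, x ∉ B → ∃ y ∈ B, y ∉ A ∧ y ≤ x := by
  unfold lexLE
  constructor
  · intro h x hx hxB
    have h1 : (A \ B).min ≤ (x : WithTop ℕ) := Finset.min_le (by simp [hx, hxB])
    have h2 := h.trans h1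
    have hne : (B \ A).Nonempty := by
      by_contra hne
      rw [Finset.not_nonempty_iff_eq_empty] at hne
      rw [hne] at h2
      simp at h2
    obtain ⟨y, hy⟩ := Finset.min_of_nonempty hne
    have := Finset.mem_of_min hy
    rw [hy] at h2
    simp only [Finset.mem_sdiff] at this
    exact ⟨y, this.1, this.2, WithTop.coe_le_coe.1 h2⟩
  · intro h
    refine Finset.le_min fun x hx => ?_
    simp only [Finset.mem_sdiff] at hx
    obtain ⟨y, hy, hyA, hyx⟩ := h x hx.1 hx.2
    exact (Finset.min_le (Finset.mem_sdiff.2 ⟨hy, hyA⟩)).trans (WithTop.coe_le_coe.2 hyx)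

theorem grChi_lt_iff (A B : Finset ℕ) :
    grChi A < grChi B ↔ ∃ d, (∀ e < d, (e ∈ A ↔ e ∈ B)) ∧ d ∉ A ∧ d ∈ B := by
  change (∃ d, (∀ e, e < d → grChi A e = grChi B e) ∧ grChi A d < grChi B d) ↔ _
  simp [grChi, Bool.lt_iff]

theorem lexLE_iff (A B : Finset ℕ) : lexLE A B ↔ grChi A ≤ grChi B := by
  have hnl : grChi A ≤ grChi B ↔ ¬ grChi B < grChi A := not_lt.symm
  rw [hnl, grChi_lt_iff, lexLE_iff_forall]
  constructor
  · rintro h ⟨d, hd, hdB, hdA⟩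
    obtain ⟨y, hy, hyA, hyd⟩ := h d hdA hdB
    rcases hyd.lt_or_eq with h1 | rfl
    · exact hyA ((hd y h1).1 hy)
    · exact hyA hdA
  · intro h x hx hxB
    by_contra hc
    push Not at hc
    apply h
    have hex : ∃ n, n ∈ A ∧ n ∉ B := ⟨x, hx, hxB⟩
    classical
    refine ⟨Nat.find hex, fun e he => ?_, (Nat.find_spec hex).2, (Nat.find_spec hex).1⟩
    have hle : Nat.find hex ≤ x := Nat.find_min' hex ⟨hx, hxB⟩
    constructor
    · intro heB
      by_contra heA
      exact absurd (hc e heB heA) (by omega)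
    · intro heA
      by_contra heB
      exact Nat.find_min hex he ⟨heA, heB⟩

theorem grChi_injective : Function.Injective grChi := by
  intro A B h
  ext n
  have := congrFun (congrArg ofLex h) n
  simpa [grChi] using this

theorem grChi_mono {A B : Finset ℕ} (h : A ⊆ B) : grChi A ≤ grChi B := by
  rw [← lexLE_iff, lexLE_iff_forall]
  intro x hx hxB
  exact absurd (h hx) hxB

theorem grChi_insert_le {A M : Finset ℕ} {n : ℕ} (h : grChi A < grChi M)
    (hM : ∀ m ∈ M, m ≤ n) (hA : ∀ a ∈ A, a < n) : grChi (insert n A) ≤ grChi M := by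
  rw [grChi_lt_iff] at h
  obtain ⟨d, hd, hdA, hdM⟩ := h
  rw [← lexLE_iff, lexLE_iff_forall]
  intro x hx hxM
  rw [Finset.mem_insert] at hx
  have hdn := hM d hdM
  rcases hx with rfl | hx
  · refine ⟨d, hdM, ?_, hdn⟩
    rw [Finset.mem_insert, not_or]
    exact ⟨fun h => hxM (h ▸ hdM), hdA⟩
  · have hxn := hA x hx
    have hdx : d ≤ x := by
      by_contra hlt
      exact hxM ((hd x (by omega)).1 hx)
    refine ⟨d, hdM, ?_, hdx⟩
    rw [Finset.mem_insert, not_or]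
    exact ⟨by omega, hdA⟩

/-! ### Generalities on indecomposable objects -/

theorem gr_indec_of_iso {X Y : C} (e : X ≅ Y) (h : Indecomposable X) : Indecomposable Y :=
  ⟨fun hz => h.1 (hz.of_iso e), fun A B i => h.2 A B (e ≪≫ i)⟩

theorem gr_isIso_of_retraction {A B : C} (hB : Indecomposable B) (hA : ¬ IsZero A)
    (i : A ⟶ B) (r : B ⟶ A) (h : i ≫ r = 𝟙 A) : IsIso i := by
  have hm : Mono i := mono_of_mono_fac h
  let S : ShortComplex C := ShortComplex.mk i (cokernel.π i) (cokernel.condition i)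
  have hS : S.Exact := ShortComplex.exact_cokernel i
  have hsp := ShortComplex.Splitting.ofExactOfRetraction S hS r h
    (by dsimp [S]; infer_instance)
  rcases hB.2 _ _ hsp.isoBinaryBiproduct with h1 | h1
  · exact absurd h1 hA
  · have : Epi i := Preadditive.epi_of_cokernel_zero (h1.eq_of_tgt _ _)
    exact isIso_of_mono_of_epi i

/-! ### Length -/

section Len

variable {len : C → ℕ}


theorem gr_series_le (hlen : ∀ Z : C, ObjLength Z (len Z)) {X : C}
    (p : LTSeries (Subobject X)) : p.length ≤ len X :=
  (hlen X).2 p.length p p.strictMono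

theorem gr_exists_series (hlen : ∀ Z : C, ObjLength Z (len Z)) (X : C) :
    ∃ p : LTSeries (Subobject X), p.length = len X := by
  obtain ⟨⟨f, hf, -, -⟩, -⟩ := hlen X
  exact ⟨LTSeries.mk _ f hf, rfl⟩

theorem gr_map_strictMono {X Y : C} (f : X ⟶ Y) [Mono f] :
    StrictMono (Subobject.map f).obj :=
  (Functor.monotone _).strictMono_of_injective (Subobject.map_obj_injective f)

theorem gr_pullback_strictMono {X Y : C} (f : X ⟶ Y) [Epi f] :
    StrictMono (Subobject.pullback f).obj := by
  refine (Functor.monotone _).strictMono_of_injective ?_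
  have key : ∀ s t : Subobject Y, (Subobject.pullback f).obj s ≤ (Subobject.pullback f).obj t →
      s ≤ t := by
    intro s t h
    have hs := Subobject.isPullback f s
    have ht := Subobject.isPullback f t
    have : Epi (Subobject.pullbackπ f s) := Abelian.epi_fst_of_isLimit _ _ hs.isLimit
    have hstrong : StrongEpi (Subobject.pullbackπ f s) := strongEpi_of_epi _
    have sq : CommSq (Subobject.ofLE _ _ h ≫ Subobject.pullbackπ f t) (Subobject.pullbackπ f s)
        t.arrow s.arrow := ⟨by rw [hs.w, Category.assoc, ht.w, Subobject.ofLE_arrow_assoc]⟩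
    exact Subobject.le_of_comm sq.lift sq.fac_right
  intro s t h
  exact le_antisymm (key s t (le_of_eq h)) (key t s (le_of_eq h.symm))

theorem gr_len_lt_of_mono (hlen : ∀ Z : C, ObjLength Z (len Z)) {X Y : C} (f : X ⟶ Y) [Mono f]
    (h : ¬ IsIso f) : len X < len Y := by
  obtain ⟨p, hp⟩ := gr_exists_series hlen X
  let q := p.map _ (gr_map_strictMono f)
  have hq : q.last < ⊤ := by
    refine lt_of_le_of_lt (b := Subobject.mk f) ?_ ?_
    · rw [← Subobject.map_top]
      exact (Subobject.map f).monotone (le_top : p.last ≤ ⊤)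
    · rw [lt_top_iff_ne_top, Ne, ← Subobject.isIso_iff_mk_eq_top]
      exact h
  have h1 := gr_series_le hlen (q.snoc ⊤ hq)
  have h2 : (q.snoc ⊤ hq).length = p.length + 1 := rfl
  omega

theorem gr_len_lt_of_epi (hlen : ∀ Z : C, ObjLength Z (len Z)) {X Y : C} (f : X ⟶ Y) [Epi f]
    (h : ¬ IsIso f) : len Y < len X := by
  obtain ⟨p, hp⟩ := gr_exists_series hlen Y
  let q := p.map _ (gr_pullback_strictMono f)
  have hq : ⊥ < q.head := by
    refine lt_of_lt_of_le (b := (Subobject.pullback f).obj ⊥) ?_ ?_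
    · rw [bot_lt_iff_ne_bot]
      intro hb
      apply h
      have h1 : ((Subobject.pullback f).obj ⊥).Factors (kernel.ι f) :=
        CategoryTheory.Limits.pullback_factors _ _ _ (by
          rw [kernel.condition]; exact Subobject.factors_zero)
      rw [hb, Subobject.bot_factors_iff_zero] at h1
      have : Mono f := Preadditive.mono_of_kernel_zero h1
      exact isIso_of_mono_of_epi f
    · exact (Subobject.pullback f).monotone (bot_le : ⊥ ≤ p.head)
  have h1 := gr_series_le hlen (q.cons ⊥ hq)
  have h2 : (q.cons ⊥ hq).length = 0 + p.length + 1 := rfl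
  omega

theorem gr_len_iso (hlen : ∀ Z : C, ObjLength Z (len Z)) {X Y : C} (e : X ≅ Y) :
    len X = len Y := by
  have key : ∀ {A B : C} (e : A ≅ B), len A ≤ len B := by
    intro A B e
    obtain ⟨p, hp⟩ := gr_exists_series hlen A
    have h1 := gr_series_le hlen (p.map _ (gr_map_strictMono e.hom))
    have h2 : (p.map _ (gr_map_strictMono e.hom)).length = p.length := rfl
    omega
  exact le_antisymm (key e) (key e.symm)

theorem gr_len_le_of_mono (hlen : ∀ Z : C, ObjLength Z (len Z)) {X Y : C} (f : X ⟶ Y) [Mono f] :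
    len X ≤ len Y := by
  by_cases h : IsIso f
  · exact (gr_len_iso hlen (asIso f)).le
  · exact (gr_len_lt_of_mono hlen f h).le

theorem gr_len_le_of_epi (hlen : ∀ Z : C, ObjLength Z (len Z)) {X Y : C} (f : X ⟶ Y) [Epi f] :
    len Y ≤ len X := by
  by_cases h : IsIso f
  · exact (gr_len_iso hlen (asIso f)).ge
  · exact (gr_len_lt_of_epi hlen f h).le

/-- Decomposition into finitely many indecomposable summands. -/
theorem gr_decomp (hlen : ∀ Z : C, ObjLength Z (len Z)) (n : ℕ) : ∀ W : C, len W = n →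
    ∃ (J : Type) (_ : Finite J) (Z : J → C) (q : ∀ j, W ⟶ Z j) (i : ∀ j, Z j ⟶ W),
      (∀ j, Indecomposable (Z j)) ∧ (∀ j, i j ≫ q j = 𝟙 _) ∧
      ∀ (T : C) (h : T ⟶ W), (∀ j, h ≫ q j = 0) → h = 0 := by
  induction n using Nat.strong_induction_on with
  | _ n ih =>
    intro W hW
    by_cases hz : IsZero W
    · exact ⟨Empty, inferInstance, fun j => j.elim, fun j => j.elim, fun j => j.elim,
        fun j => j.elim, fun j => j.elim, fun T h _ => hz.eq_of_tgt _ _⟩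
    by_cases hi : Indecomposable W
    · exact ⟨Unit, inferInstance, fun _ => W, fun _ => 𝟙 W, fun _ => 𝟙 W, fun _ => hi,
        fun _ => by simp, fun T h hh => by simpa using hh ()⟩
    have : ∃ (A B : C) (_ : W ≅ A ⊞ B), ¬ IsZero A ∧ ¬ IsZero B := by
      by_contra hc
      refine hi ⟨hz, fun A B e => ?_⟩
      by_contra hAB
      exact hc ⟨A, B, e, not_or.1 hAB⟩
    obtain ⟨A, B, e, hA, hB⟩ := this
    have hWl := gr_len_iso hlen e
    have lA : len A < len (A ⊞ B) := by
      refine gr_len_lt_of_mono hlen (biprod.inl : A ⟶ A ⊞ B) fun hiso => hB ?_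
      have h1 : (biprod.inl : A ⟶ A ⊞ B) ≫ biprod.snd = 0 := biprod.inl_snd
      have h2 : (biprod.snd : A ⊞ B ⟶ B) = 0 := (cancel_epi (biprod.inl : A ⟶ A ⊞ B)).1 (by simp)
      rw [IsZero.iff_id_eq_zero, ← biprod.inr_snd (X := A) (Y := B), h2, comp_zero]
    have lB : len B < len (A ⊞ B) := by
      refine gr_len_lt_of_mono hlen (biprod.inr : B ⟶ A ⊞ B) fun hiso => hA ?_
      have h2 : (biprod.fst : A ⊞ B ⟶ A) = 0 := (cancel_epi (biprod.inr : B ⟶ A ⊞ B)).1 (by simp)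
      rw [IsZero.iff_id_eq_zero, ← biprod.inl_fst (X := A) (Y := B), h2, comp_zero]
    obtain ⟨J, _, Z, q, i, hZ, hiq, hj⟩ := ih (len A) (by omega) A rfl
    obtain ⟨J', _, Z', q', i', hZ', hiq', hj'⟩ := ih (len B) (by omega) B rfl
    refine ⟨J ⊕ J', inferInstance, fun j => Sum.elim Z Z' j,
      fun j => match j with
        | .inl j => e.hom ≫ biprod.fst ≫ q j
        | .inr j => e.hom ≫ biprod.snd ≫ q' j,
      fun j => match j with
        | .inl j => i j ≫ biprod.inl ≫ e.inv
        | .inr j => i' j ≫ biprod.inr ≫ e.inv, ?_, ?_, ?_⟩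
    · rintro (j | j)
      · exact hZ j
      · exact hZ' j
    · rintro (j | j)
      · simpa using hiq j
      · simpa using hiq' j
    · intro T h hh
      have h1 : h ≫ e.hom ≫ biprod.fst = 0 := hj _ _ fun j => by
        have := hh (.inl j)
        dsimp only at this
        simp only [Category.assoc]
        exact this
      have h2 : h ≫ e.hom ≫ biprod.snd = 0 := hj' _ _ fun j => by
        have := hh (.inr j)
        dsimp only at this
        simp only [Category.assoc]
        exact this
      have h3 : h ≫ e.hom = 0 := by
        apply biprod.hom_ext <;> simpa
      rw [← cancel_mono e.hom, h3, zero_comp]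

/-! ### Properties of the Gabriel-Roiter measure -/

/-- The source of the image of a subobject under a monomorphism. -/
noncomputable def grMapIso {X Y : C} (f : X ⟶ Y) [Mono f] (t : Subobject X) :
    ((Subobject.map f).obj t : C) ≅ (t : C) :=
  Subobject.isoOfEq _ (Subobject.mk (t.arrow ≫ f))
    (by rw [← Subobject.map_mk, Subobject.mk_arrow]) ≪≫ Subobject.underlyingIso _

/-- The object underlying the top subobject. -/
noncomputable def grTopIso (X : C) : ((⊤ : Subobject X) : C) ≅ X := asIso (⊤ : Subobject X).arrow

theorem gr_chainVal_of_mono (hlen : ∀ Z : C, ObjLength Z (len Z)) {X Y : C}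
    (hY : Indecomposable Y) (f : X ⟶ Y) [Mono f]
    {A : Finset ℕ} (hA : IsGRChainVal len X A) : IsGRChainVal len Y (insert (len Y) A) := by
  classical
  obtain ⟨s, hs, -, hi, rfl⟩ := hA
  refine ⟨insert ⊤ (s.image (Subobject.map f).obj), ?_, by simp, ?_, ?_⟩
  · rw [Finset.coe_insert, Finset.coe_image]
    refine IsChain.insert ?_ fun b _ _ => Or.inr le_top
    rintro _ ⟨a, ha, rfl⟩ _ ⟨b, hb, rfl⟩ hab
    exact (hs.total ha hb).imp (fun h => Functor.monotone _ h) (fun h => Functor.monotone _ h)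
  · intro t ht
    simp only [Finset.mem_insert, Finset.mem_image] at ht
    rcases ht with rfl | ⟨a, ha, rfl⟩
    · exact gr_indec_of_iso (grTopIso Y).symm hY
    · exact gr_indec_of_iso (grMapIso f a).symm (hi a ha)
  · rw [Finset.image_insert, Finset.image_image, gr_len_iso hlen (grTopIso Y)]
    congr 1
    refine Finset.image_congr fun a _ => ?_
    exact gr_len_iso hlen (grMapIso f a)

theorem gr_mu_mono (hlen : ∀ Z : C, ObjLength Z (len Z)) {mu : C → Finset ℕ}
    (hmu : IsGRMeasure len mu) {X Y : C} (hX : Indecomposable X) (hY : Indecomposable Y)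
    (f : X ⟶ Y) [Mono f] : grChi (mu X) ≤ grChi (mu Y) :=
  (grChi_mono (Finset.subset_insert (len Y) _)).trans
    ((lexLE_iff _ _).1 ((hmu Y hY).2 _ (gr_chainVal_of_mono hlen hY f (hmu X hX).1)))

theorem gr_len_mem (hlen : ∀ Z : C, ObjLength Z (len Z)) {X : C} {A : Finset ℕ}
    (hA : IsGRChainVal len X A) : len X ∈ A := by
  obtain ⟨s, -, ht, -, rfl⟩ := hA
  exact Finset.mem_image.2 ⟨⊤, ht, gr_len_iso hlen (grTopIso X)⟩

theorem gr_le_len (hlen : ∀ Z : C, ObjLength Z (len Z)) {X : C} {A : Finset ℕ}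
    (hA : IsGRChainVal len X A) : ∀ a ∈ A, a ≤ len X := by
  obtain ⟨s, -, -, -, rfl⟩ := hA
  intro a ha
  obtain ⟨t, -, rfl⟩ := Finset.mem_image.1 ha
  exact gr_len_le_of_mono hlen t.arrow

theorem gr_len_eq (hlen : ∀ Z : C, ObjLength Z (len Z)) {mu : C → Finset ℕ}
    (hmu : IsGRMeasure len mu) {X Y : C} (hX : Indecomposable X) (hY : Indecomposable Y)
    (h : mu X = mu Y) : len X = len Y :=
  le_antisymm (gr_le_len hlen (hmu Y hY).1 _ (h ▸ gr_len_mem hlen (hmu X hX).1))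
    (gr_le_len hlen (hmu X hX).1 _ (h ▸ gr_len_mem hlen (hmu Y hY).1))

/-- Third basic property of the Gabriel-Roiter measure. -/
theorem gr_mu_le (hlen : ∀ Z : C, ObjLength Z (len Z)) {mu : C → Finset ℕ}
    (hmu : IsGRMeasure len mu) {X Y : C} (hX : Indecomposable X) (hY : Indecomposable Y)
    (hl : len Y ≤ len X)
    (h : ∀ t : Subobject X, t ≠ ⊤ → Indecomposable (t : C) → grChi (mu (t : C)) < grChi (mu Y)) :
    grChi (mu X) ≤ grChi (mu Y) := by
  classical
  obtain ⟨s, hs, hst, hi, hsA⟩ := (hmu X hX).1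
  let A : Finset ℕ := (s.erase ⊤).image (fun t : Subobject X => len (t : C))
  have hXA : mu X = insert (len X) A := by
    rw [← hsA, ← Finset.insert_erase hst, Finset.image_insert, gr_len_iso hlen (grTopIso X)]
  rw [hXA]
  have hM : ∀ m ∈ mu Y, m ≤ len X := fun m hm => (gr_le_len hlen (hmu Y hY).1 m hm).trans hl
  refine grChi_insert_le ?_ hM ?_
  · rcases (s.erase ⊤).eq_empty_or_nonempty with he | hne
    · have hA : A = ∅ := by simp [A, he]
      rw [hA]
      refine lt_of_le_of_ne (grChi_mono (Finset.empty_subset _)) fun heq => ?_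
      have := grChi_injective heq
      have h2 := gr_len_mem hlen (hmu Y hY).1
      rw [← this] at h2
      simp at h2
    · obtain ⟨t, ht⟩ := (s.erase ⊤).exists_maximal hne
      have hts : t ∈ s := Finset.mem_of_mem_erase ht.1
      have hle : ∀ u ∈ s.erase ⊤, u ≤ t := by
        intro u hu
        rcases hs.total (Finset.mem_of_mem_erase hu) hts with h1 | h1
        · exact h1
        · exact ht.2 hu h1
      refine lt_of_le_of_lt ?_ (h t (Finset.ne_of_mem_erase ht.1) (hi t hts))
      rw [← lexLE_iff]
      refine (hmu _ (hi t hts)).2 _ ?_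
      have iso : ∀ u ∈ s.erase ⊤,
          Nonempty (((Subobject.pullback t.arrow).obj u : C) ≅ (u : C)) := by
        intro u hu
        have h1 := Subobject.inf_eq_map_pullback t u
        rw [inf_eq_right.2 (hle u hu)] at h1
        exact ⟨(grMapIso t.arrow _).symm ≪≫ Subobject.isoOfEq _ _ h1.symm⟩
      refine ⟨(s.erase ⊤).image (Subobject.pullback t.arrow).obj, ?_, ?_, ?_, ?_⟩
      · rw [Finset.coe_image]
        rintro _ ⟨a, ha, rfl⟩ _ ⟨b, hb, rfl⟩ hab
        exact (hs.total (Finset.mem_of_mem_erase ha) (Finset.mem_of_mem_erase hb)).imp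
          (fun h => Functor.monotone _ h) (fun h => Functor.monotone _ h)
      · refine Finset.mem_image.2 ⟨t, ht.1, ?_⟩
        have := Subobject.pullback_self t.arrow
        rwa [Subobject.mk_arrow] at this
      · intro u hu
        obtain ⟨v, hv, rfl⟩ := Finset.mem_image.1 hu
        exact gr_indec_of_iso (iso v hv).some.symm (hi v (Finset.mem_of_mem_erase hv))
      · rw [Finset.image_image]
        exact Finset.image_congr fun u hu => gr_len_iso hlen (iso u hu).some
  · intro a ha
    obtain ⟨u, hu, rfl⟩ := Finset.mem_image.1 ha
    refine gr_len_lt_of_mono hlen u.arrow fun hiso => ?_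
    exact Finset.ne_of_mem_erase hu ((Subobject.isIso_arrow_iff_eq_top u).1 hiso)

/-- Ringel's main property, in a form that avoids the Krull-Schmidt theorem. -/
theorem gr_main (hlen : ∀ Z : C, ObjLength Z (len Z)) {mu : C → Finset ℕ}
    (hmu : IsGRMeasure len mu) (n : ℕ) : ∀ (X : C), len X = n → Indecomposable X →
    ∀ (J : Type) (_ : Finite J) (Z : J → C) (g : ∀ j, X ⟶ Z j), (∀ j, Indecomposable (Z j)) →
      (∀ (T : C) (h : T ⟶ X), (∀ j, h ≫ g j = 0) → h = 0) →
      (∃ j, grChi (mu X) < grChi (mu (Z j))) ∨ ∃ j, IsIso (g j) := by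
  induction n using Nat.strong_induction_on with
  | _ n ih =>
    intro X hXn hX
    -- first the case where all the components are epimorphisms
    have stepA : ∀ (J : Type) (_ : Finite J) (Z : J → C) (g : ∀ j, X ⟶ Z j),
        (∀ j, Indecomposable (Z j)) → (∀ j, Epi (g j)) →
        (∀ (T : C) (h : T ⟶ X), (∀ j, h ≫ g j = 0) → h = 0) →
        (∃ j, grChi (mu X) < grChi (mu (Z j))) ∨ ∃ j, IsIso (g j) := by
      intro J _ Z g hZ hg hj
      have : Nonempty J := by
        by_contra hne
        rw [not_nonempty_iff] at hne
        exact hX.1 ((IsZero.iff_id_eq_zero X).2 (hj _ _ fun j => hne.elim j))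
      obtain ⟨k, hk⟩ := Finite.exists_max fun j => grChi (mu (Z j))
      have hle : grChi (mu X) ≤ grChi (mu (Z k)) := by
        have := hg k
        refine gr_mu_le hlen hmu hX (hZ k) (gr_len_le_of_epi hlen (g k)) fun t ht hti => ?_
        have hnt : ¬ IsIso t.arrow := fun hh => ht ((Subobject.isIso_arrow_iff_eq_top t).1 hh)
        rcases ih (len (t : C)) (hXn ▸ gr_len_lt_of_mono hlen t.arrow hnt) _ rfl hti J inferInstance Z
          (fun j => t.arrow ≫ g j) hZ (fun T h hh => by
            rw [← cancel_mono t.arrow, zero_comp]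
            exact hj _ _ fun j => by simpa using hh j) with ⟨j, hj'⟩ | ⟨j, hj'⟩
        · exact lt_of_lt_of_le hj' (hk j)
        · exact absurd (gr_isIso_of_retraction hX hti.1 t.arrow (g j ≫ inv (t.arrow ≫ g j))
            (by rw [← Category.assoc, IsIso.hom_inv_id])) hnt
      rcases hle.lt_or_eq with h1 | h1
      · exact Or.inl ⟨k, h1⟩
      · right
        refine ⟨k, ?_⟩
        by_contra hni
        have := hg k
        have h2 := gr_len_lt_of_epi hlen (g k) hni
        have h3 := gr_len_eq hlen hmu hX (hZ k) (grChi_injective h1)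
        omega
    intro J _ Z g hZ hj
    choose K hK W q i hW hiq hjm using fun j => gr_decomp hlen _ (image (g j)) rfl
    have hmono : ∀ j k, Mono (i j k ≫ image.ι (g j)) := fun j k => by
      have : Mono (i j k) := mono_of_mono_fac (hiq j k)
      infer_instance
    have hle : ∀ j k, grChi (mu (W j k)) ≤ grChi (mu (Z j)) := fun j k => by
      have := hmono j k
      exact gr_mu_mono hlen hmu (hW j k) (hZ j) (i j k ≫ image.ι (g j))
    rcases stepA (Σ j, K j) inferInstance (fun p => W p.1 p.2)
      (fun p => factorThruImage (g p.1) ≫ q p.1 p.2) (fun p => hW p.1 p.2)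
      (fun p => by
        have : Epi (q p.1 p.2) := epi_of_epi_fac (hiq p.1 p.2)
        infer_instance)
      (fun T h hh => hj _ _ fun j => by
        have h1 : h ≫ factorThruImage (g j) = 0 := hjm j _ _ fun k => by
          simpa using hh ⟨j, k⟩
        rw [← image.fac (g j), ← Category.assoc, h1, zero_comp]) with ⟨⟨j, k⟩, h⟩ | ⟨⟨j, k⟩, h⟩
    · exact Or.inl ⟨j, lt_of_lt_of_le h (hle j k)⟩
    · dsimp only at h
      have hXW : grChi (mu X) ≤ grChi (mu (W j k)) :=
        gr_mu_mono hlen hmu hX (hW j k) (factorThruImage (g j) ≫ q j k)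
      rcases (hXW.trans (hle j k)).lt_or_eq with h1 | h1
      · exact Or.inl ⟨j, h1⟩
      · right
        refine ⟨j, ?_⟩
        have hlX := gr_len_eq hlen hmu hX (hZ j) (grChi_injective h1)
        have : Mono (factorThruImage (g j)) := mono_of_mono _ (q j k)
        have hm : Mono (g j) := by
          rw [← image.fac (g j)]
          infer_instance
        by_contra hni
        have := gr_len_lt_of_mono hlen (g j) hni
        omega

/-- If `X ⊂ Y` is a Gabriel-Roiter inclusion and `X ⊆ U ⊂ Y`, then `X` is a summand of `U`. -/
theorem gr_retraction (hlen : ∀ Z : C, ObjLength Z (len Z)) {mu : C → Finset ℕ}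
    (hmu : IsGRMeasure len mu) {X Y : C} (hpred : IsGRPred mu X Y) {U : C}
    (a : X ⟶ U) [Mono a] (u : U ⟶ Y) [Mono u] (hu : ¬ IsIso u) :
    ∃ r : U ⟶ X, a ≫ r = 𝟙 X := by
  obtain ⟨hX, hY, -, hmax⟩ := hpred
  obtain ⟨J, _, Z, q, i, hZ, hiq, hj⟩ := gr_decomp hlen _ U rfl
  rcases gr_main hlen hmu _ X rfl hX J inferInstance Z (fun j => a ≫ q j) hZ (fun T h hh => by
    rw [← cancel_mono a, zero_comp]
    exact hj _ _ fun j => by simpa using hh j) with ⟨j, h⟩ | ⟨j, h⟩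
  · exfalso
    have : Mono (i j) := mono_of_mono_fac (hiq j)
    let t : Subobject Y := Subobject.mk (i j ≫ u)
    have hti : Indecomposable (t : C) :=
      gr_indec_of_iso (Subobject.underlyingIso (i j ≫ u)).symm (hZ j)
    have htt : t ≠ ⊤ := by
      intro ht
      have h1 : IsIso (i j ≫ u) := (Subobject.isIso_iff_mk_eq_top _).2 ht
      have : Epi u := epi_of_epi (i j) u
      exact hu (isIso_of_mono_of_epi u)
    have h2 := (lexLE_iff _ _).1 (hmax t htt hti)
    have h3 := gr_mu_mono hlen hmu (hZ j) hti (Subobject.underlyingIso (i j ≫ u)).inv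
    exact absurd h (not_lt.2 (h3.trans h2))
  · exact ⟨q j ≫ inv (a ≫ q j), by rw [← Category.assoc, IsIso.hom_inv_id]⟩

/-- The partial section of the quotient map over a proper subobject of the quotient. -/
theorem gr_section (hlen : ∀ Z : C, ObjLength Z (len Z)) {mu : C → Finset ℕ}
    (hmu : IsGRMeasure len mu) {X Y : C} (hpred : IsGRPred mu X Y)
    (f : X ⟶ Y) [Mono f] {A : C} (a : A ⟶ cokernel f) [Mono a] (ha : ¬ Epi a) :
    ∃ s : A ⟶ Y, s ≫ cokernel.π f = a := by
  let U := pullback (cokernel.π f) a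
  let u : U ⟶ Y := pullback.fst _ _
  let v : U ⟶ A := pullback.snd _ _
  have huv : u ≫ cokernel.π f = v ≫ a := pullback.condition
  have hv : Epi v := by dsimp [v]; infer_instance
  let b : X ⟶ U := pullback.lift f 0 (by simp)
  have hbu : b ≫ u = f := pullback.lift_fst _ _ _
  have hbv : b ≫ v = 0 := pullback.lift_snd _ _ _
  have hb : Mono b := mono_of_mono_fac hbu
  have hu : ¬ IsIso u := by
    intro hiso
    apply ha
    have : Epi (v ≫ a) := by rw [← huv]; infer_instance
    exact epi_of_epi v a
  obtain ⟨r, hr⟩ := gr_retraction hlen hmu hpred b u hu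
  -- `u - r ≫ f` kills the kernel of `v`
  have hker : kernel.ι v ≫ (u - r ≫ f) = 0 := by
    have h1 : (kernel.ι v ≫ u) ≫ cokernel.π f = 0 := by
      rw [Category.assoc, huv, kernel.condition_assoc, zero_comp]
    have h2 : ∃ w, w ≫ f = kernel.ι v ≫ u :=
      ⟨Abelian.monoLift f _ h1, Abelian.monoLift_comp f _ h1⟩
    obtain ⟨w, hw⟩ := h2
    have h3 : w ≫ b = kernel.ι v := by
      apply pullback.hom_ext
      · change (w ≫ b) ≫ u = kernel.ι v ≫ u
        rw [Category.assoc, hbu, hw]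
      · change (w ≫ b) ≫ v = kernel.ι v ≫ v
        rw [Category.assoc, hbv, comp_zero, kernel.condition]
    rw [Preadditive.comp_sub, ← h3, Category.assoc, hbu, Category.assoc, reassoc_of% hr, sub_self]
  refine ⟨Abelian.epiDesc v _ hker, ?_⟩
  rw [← cancel_epi v, ← Category.assoc, Abelian.comp_epiDesc, Preadditive.sub_comp, huv]
  simp

end Len

/-- (Ringel) If `X ⊂ Y` is a Gabriel-Roiter inclusion between indecomposable
objects, then the quotient `Y/X` is indecomposable. -/
theorem grInclusion_cokernel_indecomposable
    (len : C → ℕ) (hlen : ∀ Z : C, ObjLength Z (len Z))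
    (mu : C → Finset ℕ) (hmu : IsGRMeasure len mu)
    (X Y : C) (hpred : IsGRPred mu X Y)
    (f : X ⟶ Y) (hf : Mono f) (hfni : ¬ IsIso f) :
    Indecomposable (cokernel f) := by
  refine ⟨fun hz => hfni ?_, fun A B e => ?_⟩
  · have : Epi f := Preadditive.epi_of_cokernel_zero (hz.eq_of_tgt _ _)
    exact isIso_of_mono_of_epi f
  by_contra hAB
  obtain ⟨hA, hB⟩ := not_or.1 hAB
  obtain ⟨s, hs⟩ := gr_section hlen hmu hpred f (biprod.inl ≫ e.inv) (by
    intro he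
    apply hB
    have h2 : e.hom ≫ (biprod.snd : A ⊞ B ⟶ B) = 0 :=
      (cancel_epi ((biprod.inl : A ⟶ A ⊞ B) ≫ e.inv)).1 (by simp)
    have h3 : (biprod.snd : A ⊞ B ⟶ B) = 0 := by
      rw [← cancel_epi e.hom, h2, comp_zero]
    rw [IsZero.iff_id_eq_zero, ← biprod.inr_snd (X := A) (Y := B), h3, comp_zero])
  obtain ⟨s', hs'⟩ := gr_section hlen hmu hpred f (biprod.inr ≫ e.inv) (by
    intro he
    apply hA
    have h2 : e.hom ≫ (biprod.fst : A ⊞ B ⟶ A) = 0 :=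
      (cancel_epi ((biprod.inr : B ⟶ A ⊞ B) ≫ e.inv)).1 (by simp)
    have h3 : (biprod.fst : A ⊞ B ⟶ A) = 0 := by
      rw [← cancel_epi e.hom, h2, comp_zero]
    rw [IsZero.iff_id_eq_zero, ← biprod.inl_fst (X := A) (Y := B), h3, comp_zero])
  have hsec : (e.hom ≫ biprod.desc s s') ≫ cokernel.π f = 𝟙 _ := by
    have h1 : biprod.desc s s' ≫ cokernel.π f = e.inv := by
      apply biprod.hom_ext' <;> simp [hs, hs']
    rw [Category.assoc, h1, e.hom_inv_id]
  let S : ShortComplex C := ShortComplex.mk f (cokernel.π f) (cokernel.condition f)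
  have hS : S.Exact := ShortComplex.exact_cokernel f
  have hsp := ShortComplex.Splitting.ofExactOfSection S hS _ hsec hf
  exact hfni (gr_isIso_of_retraction hpred.2.1 hpred.1.1 f hsp.r hsp.f_r)
end

section
/- (Ringel) Let A be an abelian length category with Gabriel-Roiter measure μ, and M a set of values of μ closed under predecessors (μ(X_1) ≤ μ(X_2) and μ(X_2) ∈ M imply μ(X_1) ∈ M). Then the full subcategory A(M) of objects all of whose indecomposable direct summands X satisfy μ(X) ∈ M is covariantly finite in A. -/
open CategoryTheory CategoryTheory.Limits

variable {C : Type*} [Category C] [Abelian C]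

/-! ### The strict lexicographic order -/

/-- Strict version of the lexicographic order, with an explicit witness. -/
def LexW (X Y : Finset ℕ) : Prop :=
  ∃ n, n ∈ Y ∧ n ∉ X ∧ ∀ k < n, (k ∈ X ↔ k ∈ Y)

lemma lexLE_of_lexW {X Y : Finset ℕ} (h : LexW X Y) : lexLE X Y := by
  obtain ⟨n, hY, hX, hk⟩ := h
  unfold lexLE
  refine (Finset.min_le (a := n) (by simp [hY, hX])).trans ?_
  refine Finset.le_min ?_
  intro b hb
  simp only [Finset.mem_sdiff] at hb
  by_contra hlt
  have hlt' : b < n := by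
    rw [not_le] at hlt
    exact_mod_cast hlt
  exact hb.2 ((hk b hlt').1 hb.1)

lemma eq_or_lexW_of_lexLE {X Y : Finset ℕ} (h : lexLE X Y) : X = Y ∨ LexW X Y := by
  unfold lexLE at h
  rcases Finset.eq_empty_or_nonempty (Y \ X) with he | hne
  · left
    rw [he, Finset.min_empty, top_le_iff, Finset.min_eq_top] at h
    exact le_antisymm (Finset.sdiff_eq_empty_iff_subset.1 h) (Finset.sdiff_eq_empty_iff_subset.1 he)
  · right
    obtain ⟨n, hn⟩ := Finset.min_of_nonempty hne
    have hmem := Finset.mem_of_min hn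
    simp only [Finset.mem_sdiff] at hmem
    refine ⟨n, hmem.1, hmem.2, ?_⟩
    intro k hk
    constructor
    · intro hkX
      by_contra hkY
      have h1 : (X \ Y).min ≤ (k : WithTop ℕ) := Finset.min_le (by simp [hkX, hkY])
      have h2 := h.trans h1
      rw [hn] at h2
      have h3 : n ≤ k := WithTop.coe_le_coe.1 h2
      omega
    · intro hkY
      by_contra hkX
      have h1 : (Y \ X).min ≤ (k : WithTop ℕ) := Finset.min_le (by simp [hkX, hkY])
      rw [hn] at h1
      have h3 : n ≤ k := WithTop.coe_le_coe.1 h1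
      omega

lemma LexW.trans {X Y Z : Finset ℕ} (h : LexW X Y) (h' : LexW Y Z) : LexW X Z := by
  obtain ⟨n, hY, hX, hk⟩ := h
  obtain ⟨m, hZ, hY', hk'⟩ := h'
  rcases lt_trichotomy n m with hl | hl | hl
  · exact ⟨n, (hk' n hl).1 hY, hX, fun k hkn => (hk k hkn).trans (hk' k (hkn.trans hl))⟩
  · subst hl; exact absurd hY hY'
  · exact ⟨m, hZ, fun h => hY' ((hk m hl).1 h),
      fun k hkn => (hk k (hkn.trans hl)).trans (hk' k hkn)⟩

lemma LexW.trans_le {X Y Z : Finset ℕ} (h : LexW X Y) (h' : lexLE Y Z) : LexW X Z := by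
  rcases eq_or_lexW_of_lexLE h' with rfl | h'
  · exact h
  · exact h.trans h'

lemma LexW.le_trans {X Y Z : Finset ℕ} (h : lexLE X Y) (h' : LexW Y Z) : LexW X Z := by
  rcases eq_or_lexW_of_lexLE h with rfl | h
  · exact h'
  · exact h.trans h'

lemma lexLE_rfl (X : Finset ℕ) : lexLE X X := le_rfl

lemma LexW.insert {A B : Finset ℕ} {N : ℕ} (h : LexW A B) (hB : ∀ b ∈ B, b < N) :
    LexW (insert N A) B := by
  obtain ⟨n, hY, hX, hk⟩ := h
  have := hB n hY
  refine ⟨n, hY, ?_, ?_⟩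
  · simp only [Finset.mem_insert]
    rintro (h | h)
    · omega
    · exact hX h
  · intro k hkn
    rw [← hk k hkn]
    simp only [Finset.mem_insert]
    constructor
    · rintro (h | h)
      · omega
      · exact h
    · exact Or.inr

lemma lexW_empty {B : Finset ℕ} (hB : B.Nonempty) : LexW ∅ B := by
  refine ⟨B.min' hB, B.min'_mem hB, by simp, ?_⟩
  intro k hk
  simp only [Finset.notMem_empty, false_iff]
  intro h
  have := B.min'_le k h
  omega

lemma lexW_insert_self {A : Finset ℕ} {N : ℕ} (h : N ∉ A) : LexW A (insert N A) := by
  refine ⟨N, by simp, h, ?_⟩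
  intro k hk
  simp only [Finset.mem_insert]
  constructor
  · exact Or.inr
  · rintro (h | h)
    · omega
    · exact h

/-! ### Subobjects and lengths -/

lemma map_le_map_iff {A B : C} (f : A ⟶ B) [Mono f] (S T : Subobject A) :
    (Subobject.map f).obj S ≤ (Subobject.map f).obj T ↔ S ≤ T := by
  constructor
  · intro h
    have := (Subobject.pullback f).monotone h
    rwa [Subobject.pullback_map_self, Subobject.pullback_map_self] at this
  · intro h
    exact (Subobject.map f).monotone h

lemma map_lt_top {A B : C} (f : A ⟶ B) [Mono f] (hf : ¬ IsIso f) (S : Subobject A) :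
    (Subobject.map f).obj S < ⊤ := by
  refine lt_of_le_of_lt ((Subobject.map f).monotone (le_top : S ≤ ⊤)) ?_
  rw [Subobject.map_top, lt_top_iff_ne_top]
  intro h
  exact hf ((Subobject.isIso_iff_mk_eq_top f).2 h)

/-- The underlying object of the image of a subobject under a monomorphism. -/
noncomputable def mapIsoAux {A B : C} (f : A ⟶ B) [Mono f] (S : Subobject A) :
    (((Subobject.map f).obj S : Subobject B) : C) ≅ (S : C) := by
  refine (Subobject.isoOfEqMk ((Subobject.map f).obj S) (S.arrow ≫ f) ?_)
  rw [← Subobject.map_mk, Subobject.mk_arrow]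

lemma pullback_le_iff {A B : C} (e : A ⟶ B) [Epi e] (S T : Subobject B) :
    (Subobject.pullback e).obj S ≤ (Subobject.pullback e).obj T ↔ S ≤ T := by
  constructor
  · intro h
    have hS := Subobject.isPullback e S
    have hT := Subobject.isPullback e T
    have : Epi (Subobject.pullbackπ e S) :=
      Abelian.epi_fst_of_isLimit _ _ hS.isLimit
    have hz : S.arrow ≫ cokernel.π T.arrow = 0 := by
      rw [← cancel_epi (Subobject.pullbackπ e S), ← Category.assoc, hS.w, comp_zero,
        ← Subobject.ofLE_arrow h, Category.assoc, Category.assoc, ← Category.assoc _ e, ← hT.w]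
      simp
    exact Subobject.le_of_comm (Abelian.monoLift T.arrow S.arrow hz)
      (Abelian.monoLift_comp _ _ _)
  · intro h
    exact (Subobject.pullback e).monotone h

lemma len_lt_of_mono {len : C → ℕ} (hlen : ∀ Z : C, ObjLength Z (len Z))
    {A B : C} (f : A ⟶ B) [Mono f] (hf : ¬ IsIso f) : len A < len B := by
  obtain ⟨⟨c, hc, -, -⟩, -⟩ := hlen A
  refine (hlen B).2 (len A + 1)
    (Fin.snoc (α := fun _ => Subobject B) (fun i => (Subobject.map f).obj (c i)) ⊤) ?_
  rw [Fin.strictMono_iff_lt_succ]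
  intro i
  refine Fin.lastCases ?_ (fun j => ?_) i
  · simp only [Fin.succ_last, Fin.snoc_last, Fin.snoc_castSucc]
    exact map_lt_top f hf _
  · rw [Fin.succ_castSucc, Fin.snoc_castSucc, Fin.snoc_castSucc]
    exact lt_of_le_not_ge ((map_le_map_iff _ _ _).2 (hc Fin.castSucc_lt_succ).le)
      (fun h => (hc Fin.castSucc_lt_succ).not_ge ((map_le_map_iff _ _ _).1 h))

lemma len_iso {len : C → ℕ} (hlen : ∀ Z : C, ObjLength Z (len Z))
    {A B : C} (i : A ≅ B) : len A = len B := by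
  have key : ∀ {A B : C} (i : A ≅ B), len A ≤ len B := by
    intro A B i
    obtain ⟨⟨c, hc, -, -⟩, -⟩ := hlen A
    refine (hlen B).2 (len A) (fun j => (Subobject.map i.hom).obj (c j)) ?_
    intro a b hab
    exact lt_of_le_not_ge ((map_le_map_iff _ _ _).2 (hc hab).le)
      (fun h => (hc hab).not_ge ((map_le_map_iff _ _ _).1 h))
  exact le_antisymm (key i) (key i.symm)

lemma len_lt_of_epi {len : C → ℕ} (hlen : ∀ Z : C, ObjLength Z (len Z))
    {A B : C} (f : A ⟶ B) [Epi f] (hf : ¬ IsIso f) : len B < len A := by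
  obtain ⟨⟨c, hc, -, -⟩, -⟩ := hlen B
  refine (hlen A).2 (len B + 1)
    (Fin.cons (α := fun _ => Subobject A) ⊥ (fun i => (Subobject.pullback f).obj (c i))) ?_
  rw [Fin.strictMono_iff_lt_succ]
  intro i
  refine Fin.cases ?_ (fun j => ?_) i
  · simp only [Fin.castSucc_zero, Fin.cons_zero, Fin.cons_succ]
    rw [bot_lt_iff_ne_bot]
    intro h
    apply hf
    have : Mono f := by
      apply Abelian.mono_of_kernel_ι_eq_zero
      have hle : Subobject.mk (kernel.ι f) ≤ (Subobject.pullback f).obj (c 0) := by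
        refine Subobject.mk_le_of_comm
          ((Subobject.isPullback f (c 0)).lift 0 (kernel.ι f) (by simp)) ?_
        exact (Subobject.isPullback f (c 0)).lift_snd _ _ _
      rw [h, le_bot_iff] at hle
      exact (Subobject.mk_eq_bot_iff_zero).1 hle
    exact isIso_of_mono_of_epi f
  · rw [Fin.castSucc_succ, Fin.cons_succ, Fin.cons_succ]
    exact lt_of_le_not_ge ((pullback_le_iff _ _ _).2 (hc Fin.castSucc_lt_succ).le)
      (fun h => (hc Fin.castSucc_lt_succ).not_ge ((pullback_le_iff _ _ _).1 h))

/-! ### Indecomposables and retracts -/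

lemma indecomposable_of_iso {A B : C} (i : A ≅ B) (h : Indecomposable A) : Indecomposable B :=
  ⟨fun hB => h.1 (hB.of_iso i), fun Y Z j => h.2 Y Z (i ≪≫ j)⟩

lemma retract_iso_biprod {D I : C} (s : D ⟶ I) (p : I ⟶ D) (hsp : s ≫ p = 𝟙 D) :
    Nonempty (I ≅ D ⊞ cokernel s) := by
  have : IsSplitMono s := IsSplitMono.mk' ⟨p, hsp⟩
  exact ⟨biprod.uniqueUpToIso _ _
    (isBilimitBinaryBiconeOfIsSplitMonoOfCokernel (cokernelIsCokernel s))⟩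

lemma isIso_of_split_indecomposable {D I : C} (hD : ¬ IsZero D) (hI : Indecomposable I)
    (s : D ⟶ I) (p : I ⟶ D) (hsp : s ≫ p = 𝟙 D) : IsIso s := by
  obtain ⟨i⟩ := retract_iso_biprod s p hsp
  rcases hI.2 _ _ i with h | h
  · exact absurd h hD
  · have : IsSplitMono s := IsSplitMono.mk' ⟨p, hsp⟩
    have : Epi s := Abelian.epi_of_cokernel_π_eq_zero _ (h.eq_of_tgt _ _)
    exact isIso_of_mono_of_epi s

lemma exists_indecomposable_retract {len : C → ℕ} (hlen : ∀ Z : C, ObjLength Z (len Z)) (n : ℕ) :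
    ∀ (I : C), len I ≤ n → ∀ {W : C} (h : W ⟶ I), h ≠ 0 →
    ∃ (D : C) (s : D ⟶ I) (p : I ⟶ D), Indecomposable D ∧ s ≫ p = 𝟙 D ∧ h ≫ p ≠ 0 := by
  induction n with
  | zero =>
    intro I hI W h hne
    exfalso
    apply hne
    obtain ⟨O, hO⟩ := HasZeroObject.zero (C := C)
    have hm : Mono (0 : O ⟶ I) := ⟨fun _ _ _ => hO.eq_of_tgt _ _⟩
    have h0 : IsIso (0 : O ⟶ I) := by
      by_contra hiso
      have := len_lt_of_mono hlen _ hiso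
      omega
    have hz : IsZero I := hO.of_iso (asIso (0 : O ⟶ I)).symm
    exact hz.eq_of_tgt _ _
  | succ n ih =>
    intro I hI W h hne
    by_cases hind : Indecomposable I
    · exact ⟨I, 𝟙 I, 𝟙 I, hind, by simp, by simpa using hne⟩
    · have hIz : ¬ IsZero I := fun hz => hne (hz.eq_of_tgt _ _)
      unfold Indecomposable at hind
      push Not at hind
      obtain ⟨A, B, i, hA, hB⟩ := hind hIz
      have step : ∀ {A B : C} (i : I ≅ A ⊞ B), ¬ IsZero B → h ≫ i.hom ≫ biprod.fst ≠ 0 →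
          ∃ (D : C) (s : D ⟶ I) (p : I ⟶ D), Indecomposable D ∧ s ≫ p = 𝟙 D ∧ h ≫ p ≠ 0 := by
        intro A B i hB hne'
        have hl : len A < len I := by
          rw [len_iso hlen i]
          apply len_lt_of_mono hlen (biprod.inl : A ⟶ A ⊞ B)
          intro hiso
          apply hB
          rw [IsZero.iff_id_eq_zero]
          have h1 : (biprod.snd : A ⊞ B ⟶ B) = 0 := by
            rw [← cancel_epi (biprod.inl : A ⟶ A ⊞ B)]
            simp
          rw [← biprod.inr_snd (X := A), h1, comp_zero]
        obtain ⟨D, s, p, hD, hsp, hp⟩ := ih A (by omega) _ hne'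
        refine ⟨D, s ≫ biprod.inl ≫ i.inv, i.hom ≫ biprod.fst ≫ p, hD, by simp [hsp], ?_⟩
        simpa using hp
      by_cases h1 : h ≫ i.hom ≫ biprod.fst = 0
      · refine step (i ≪≫ biprod.braiding A B) hA ?_
        intro h2
        apply hne
        rw [← cancel_mono i.hom]
        ext
        · simpa using h1
        · simpa using h2
      · exact step i hB h1

/-! ### Basic properties of the Gabriel-Roiter measure -/

lemma len_sub_le {len : C → ℕ} (hlen : ∀ Z : C, ObjLength Z (len Z))
    {A B : C} (f : A ⟶ B) [Mono f] : len A ≤ len B := by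
  by_cases h : IsIso f
  · exact (len_iso hlen (asIso f)).le
  · exact (len_lt_of_mono hlen f h).le

lemma grChainVal_le {len : C → ℕ} (hlen : ∀ Z : C, ObjLength Z (len Z))
    {X : C} {A : Finset ℕ} (h : IsGRChainVal len X A) : ∀ a ∈ A, a ≤ len X := by
  obtain ⟨s, -, -, -, rfl⟩ := h
  intro a ha
  obtain ⟨t, -, rfl⟩ := Finset.mem_image.1 ha
  exact len_sub_le hlen t.arrow

lemma grChainVal_nonempty {len : C → ℕ} 
    {X : C} {A : Finset ℕ} (h : IsGRChainVal len X A) : A.Nonempty := by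
  obtain ⟨s, -, ht, -, rfl⟩ := h
  exact ⟨_, Finset.mem_image_of_mem _ ht⟩

lemma len_top {len : C → ℕ} (hlen : ∀ Z : C, ObjLength Z (len Z)) (X : C) :
    len ((⊤ : Subobject X) : C) = len X :=
  len_iso hlen (asIso (⊤ : Subobject X).arrow)

lemma grChainVal_mono {len : C → ℕ} (hlen : ∀ Z : C, ObjLength Z (len Z))
    {X Y : C} (hY : Indecomposable Y) (f : X ⟶ Y) [Mono f] {A : Finset ℕ}
    (h : IsGRChainVal len X A) : IsGRChainVal len Y (insert (len Y) A) := by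
  classical
  obtain ⟨s, hc, ht, hi, rfl⟩ := h
  refine ⟨insert ⊤ (s.image (Subobject.map f).obj), ?_, by simp, ?_, ?_⟩
  · rw [Finset.coe_insert]
    refine IsChain.insert ?_ (fun b _ _ => Or.inr le_top)
    rw [Finset.coe_image]
    rintro _ ⟨a, ha, rfl⟩ _ ⟨b, hb, rfl⟩ -
    rcases hc.total ha hb with h | h
    · exact Or.inl ((Subobject.map f).monotone h)
    · exact Or.inr ((Subobject.map f).monotone h)
  · intro t ht
    rcases Finset.mem_insert.1 ht with rfl | ht
    · exact indecomposable_of_iso (asIso (⊤ : Subobject Y).arrow).symm hY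
    · obtain ⟨a, ha, rfl⟩ := Finset.mem_image.1 ht
      exact indecomposable_of_iso (mapIsoAux f a).symm (hi a ha)
  · rw [Finset.image_insert, len_top hlen, Finset.image_image]
    congr 1
    apply Finset.image_congr
    intro a _
    exact len_iso hlen (mapIsoAux f a)

lemma mu_lt_of_mono {len : C → ℕ} (hlen : ∀ Z : C, ObjLength Z (len Z))
    {mu : C → Finset ℕ} (hmu : IsGRMeasure len mu) {X Y : C} (hX : Indecomposable X)
    (hY : Indecomposable Y) (f : X ⟶ Y) [Mono f] (hf : ¬ IsIso f) : LexW (mu X) (mu Y) := by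
  have h1 := grChainVal_mono hlen hY f (hmu X hX).1
  refine LexW.trans_le (lexW_insert_self ?_) ((hmu Y hY).2 _ h1)
  intro h
  have := grChainVal_le hlen (hmu X hX).1 _ h
  have := len_lt_of_mono hlen f hf
  omega

lemma len_mem_grChainVal {len : C → ℕ} (hlen : ∀ Z : C, ObjLength Z (len Z))
    {X : C} {A : Finset ℕ} (h : IsGRChainVal len X A) : len X ∈ A := by
  obtain ⟨s, -, ht, -, rfl⟩ := h
  rw [← len_top hlen X]
  exact Finset.mem_image_of_mem _ ht

lemma mu_le_of_mono {len : C → ℕ} (hlen : ∀ Z : C, ObjLength Z (len Z))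
    {mu : C → Finset ℕ} (hmu : IsGRMeasure len mu) {X Y : C} (hX : Indecomposable X)
    (hY : Indecomposable Y) (f : X ⟶ Y) [Mono f] : lexLE (mu X) (mu Y) := by
  by_cases hf : IsIso f
  · have h1 := grChainVal_mono hlen hY f (hmu X hX).1
    rw [← len_iso hlen (asIso f), Finset.insert_eq_of_mem (len_mem_grChainVal hlen (hmu X hX).1)]
      at h1
    exact (hmu Y hY).2 _ h1
  · exact lexLE_of_lexW (mu_lt_of_mono hlen hmu hX hY f hf)

lemma grChainVal_cases {len : C → ℕ} (hlen : ∀ Z : C, ObjLength Z (len Z))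
    {Z : C} {A : Finset ℕ} (h : IsGRChainVal len Z A) :
    A = insert (len Z) ∅ ∨ ∃ (Z' : C) (m : Z' ⟶ Z) (A' : Finset ℕ), Mono m ∧ ¬ IsIso m ∧
      Indecomposable Z' ∧ IsGRChainVal len Z' A' ∧ A = insert (len Z) A' := by
  classical
  obtain ⟨s, hc, ht, hi, rfl⟩ := h
  have hs : s = insert ⊤ (s.erase ⊤) := (Finset.insert_erase ht).symm
  rcases Finset.eq_empty_or_nonempty (s.erase ⊤) with he | hne
  · left
    rw [hs, he, Finset.image_insert, len_top hlen, Finset.image_empty]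
  · right
    obtain ⟨t, htm, htmax⟩ := (s.erase ⊤).exists_maximal hne
    have hts : t ∈ s := Finset.mem_of_mem_erase htm
    have hle : ∀ u ∈ s.erase ⊤, u ≤ t := by
      intro u hu
      rcases hc.total (Finset.mem_of_mem_erase hu) hts with h | h
      · exact h
      · exact htmax hu h
    have hmp : ∀ u ∈ s.erase ⊤,
        (Subobject.map t.arrow).obj ((Subobject.pullback t.arrow).obj u) = u := by
      intro u hu
      rw [← Subobject.inf_eq_map_pullback]
      exact inf_eq_right.2 (hle u hu)
    have hiso : ∀ u ∈ s.erase ⊤,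
        Nonempty ((((Subobject.pullback t.arrow).obj u : Subobject (t : C)) : C) ≅ (u : C)) := by
      intro u hu
      exact ⟨(mapIsoAux t.arrow _).symm ≪≫ Subobject.isoOfEq _ _ (hmp u hu)⟩
    refine ⟨(t : C), t.arrow, (s.erase ⊤).image (fun u : Subobject Z => len (u : C)), inferInstance, ?_,
      hi t hts, ⟨(s.erase ⊤).image (Subobject.pullback t.arrow).obj, ?_, ?_, ?_, ?_⟩, ?_⟩
    · intro h
      exact Finset.ne_of_mem_erase htm (Subobject.eq_top_of_isIso_arrow t)
    · rw [Finset.coe_image]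
      rintro _ ⟨a, ha, rfl⟩ _ ⟨b, hb, rfl⟩ -
      rcases hc.total (Finset.mem_of_mem_erase ha) (Finset.mem_of_mem_erase hb) with h | h
      · exact Or.inl ((Subobject.pullback t.arrow).monotone h)
      · exact Or.inr ((Subobject.pullback t.arrow).monotone h)
    · exact Finset.mem_image.2 ⟨t, htm, Subobject.pullback_self t.arrow ▸ by
        rw [Subobject.mk_arrow]⟩
    · intro u hu
      obtain ⟨a, ha, rfl⟩ := Finset.mem_image.1 hu
      exact indecomposable_of_iso (hiso a ha).some.symm (hi a (Finset.mem_of_mem_erase ha))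
    · rw [Finset.image_image]
      apply Finset.image_congr
      intro a ha
      exact len_iso hlen (hiso a ha).some
    · conv_lhs => rw [hs]
      rw [Finset.image_insert, len_top hlen]

/-! ### The main property of Gabriel -/

/-- The main property for a jointly monic family of epimorphisms, given the main property for
all indecomposables of smaller length; and the general case. -/
theorem gabriel_main {len : C → ℕ} (hlen : ∀ Z : C, ObjLength Z (len Z))
    {mu : C → Finset ℕ} (hmu : IsGRMeasure len mu) (n : ℕ) :
    ∀ (Z : C), len Z < n → Indecomposable Z → ∀ P : ∀ Y : C, (Z ⟶ Y) → Prop,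
      (∀ Y f, P Y f → Indecomposable Y) →
      (∀ (W : C) (g : W ⟶ Z), (∀ Y f, P Y f → g ≫ f = 0) → g = 0) →
      ∃ Y f, P Y f ∧ (IsIso f ∨ LexW (mu Z) (mu Y)) := by
  induction n with
  | zero => intro Z h; omega
  | succ n ih =>
    intro Z hZn hZ
    -- the case of epimorphisms
    have epiCase : ∀ P : ∀ Y : C, (Z ⟶ Y) → Prop,
        (∀ Y f, P Y f → Indecomposable Y ∧ Epi f) →
        (∀ (W : C) (g : W ⟶ Z), (∀ Y f, P Y f → g ≫ f = 0) → g = 0) →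
        ∃ Y f, P Y f ∧ (IsIso f ∨ LexW (mu Z) (mu Y)) := by
      intro P hP hjoint
      by_cases hex : ∃ Y f, P Y f ∧ IsIso f
      · obtain ⟨Y, f, h, hi⟩ := hex
        exact ⟨Y, f, h, Or.inl hi⟩
      push Not at hex
      have hbound : ∀ Y f, P Y f → ∀ b ∈ mu Y, b < len Z := by
        intro Y f h b hb
        have := (hP Y f h).2
        have h1 := len_lt_of_epi hlen f (hex Y f h)
        have h2 := grChainVal_le hlen (hmu Y (hP Y f h).1).1 b hb
        omega
      rcases grChainVal_cases hlen (hmu Z hZ).1 with hA | ⟨Z', m, A', hm, hmi, hZ', hA', hA⟩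
      · have : ∃ Y f, P Y f := by
          by_contra hno
          push Not at hno
          apply hZ.1
          rw [IsZero.iff_id_eq_zero]
          exact hjoint _ _ (fun Y f h => absurd h (hno Y f))
        obtain ⟨Y, f, h⟩ := this
        refine ⟨Y, f, h, Or.inr ?_⟩
        rw [hA]
        exact (lexW_empty (grChainVal_nonempty (hmu Y (hP Y f h).1).1)).insert (hbound Y f h)
      · have hl := len_lt_of_mono hlen m hmi
        obtain ⟨Y, g, ⟨f, h, rfl⟩, hg⟩ := ih Z' (by omega) hZ'
          (fun Y g => ∃ f, P Y f ∧ g = m ≫ f) (fun Y g ⟨f, h, _⟩ => (hP Y f h).1) (by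
            intro W g hg
            rw [← cancel_mono m, zero_comp]
            apply hjoint
            intro Y f h
            rw [Category.assoc]
            exact hg Y _ ⟨f, h, rfl⟩)
        rcases hg with hiso | hlt
        · exfalso
          apply hmi
          exact isIso_of_split_indecomposable hZ'.1 hZ m (f ≫ inv (m ≫ f))
            (by rw [← Category.assoc]; exact IsIso.hom_inv_id _)
        · refine ⟨Y, f, h, Or.inr ?_⟩
          rw [hA]
          exact (LexW.le_trans ((hmu Z' hZ').2 _ hA') hlt).insert (hbound Y f h)
    intro P hP hjoint
    obtain ⟨D, g, ⟨Y, f, hf, s, p, hD, hsp, rfl⟩, hg⟩ := epiCase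
      (fun D g => ∃ (Y : C) (f : Z ⟶ Y), P Y f ∧ ∃ (s : D ⟶ Abelian.image f)
        (p : Abelian.image f ⟶ D), Indecomposable D ∧ s ≫ p = 𝟙 D ∧
          g = Abelian.factorThruImage f ≫ p)
      (by
        rintro D g ⟨Y, f, hf, s, p, hD, hsp, rfl⟩
        have : IsSplitEpi p := IsSplitEpi.mk' ⟨s, hsp⟩
        exact ⟨hD, epi_comp _ _⟩)
      (by
        intro W g hg
        apply hjoint
        intro Y f hf
        by_contra hne
        have hne' : g ≫ Abelian.factorThruImage f ≠ 0 := by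
          intro h0
          apply hne
          rw [← Abelian.image.fac f, ← Category.assoc, h0, zero_comp]
        obtain ⟨D, s, p, hD, hsp, hp⟩ :=
          exists_indecomposable_retract hlen _ (Abelian.image f) le_rfl _ hne'
        apply hp
        rw [Category.assoc]
        exact hg D _ ⟨Y, f, hf, s, p, hD, hsp, rfl⟩)
    have hY := hP Y f hf
    refine ⟨Y, f, hf, ?_⟩
    rcases hg with hiso | hlt
    · by_cases hfi : IsIso f
      · exact Or.inl hfi
      · right
        have : Mono (Abelian.factorThruImage f) := mono_of_mono _ p
        have : Mono f := by
          rw [← Abelian.image.fac f]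
          exact mono_comp _ _
        exact mu_lt_of_mono hlen hmu hZ hY f hfi
    · right
      have : IsSplitMono s := IsSplitMono.mk' ⟨p, hsp⟩
      exact hlt.trans_le (mu_le_of_mono hlen hmu hD hY (s ≫ Abelian.image.ι f))

/-- Membership in the subcategory `A(M)`. -/
def InAM (mu : C → Finset ℕ) (M : Set (Finset ℕ)) (Y : C) : Prop :=
  ∀ (D E : C), Indecomposable D → Nonempty (Y ≅ D ⊞ E) → mu D ∈ M

lemma inAM_of_joint {len : C → ℕ} (hlen : ∀ Z : C, ObjLength Z (len Z))
    {mu : C → Finset ℕ} (hmu : IsGRMeasure len mu) {M : Set (Finset ℕ)}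
    (hM : ∀ X Y : C, Indecomposable X → Indecomposable Y →
      lexLE (mu X) (mu Y) → mu Y ∈ M → mu X ∈ M)
    (Y : C) (P : ∀ Z : C, (Y ⟶ Z) → Prop) (hP : ∀ Z f, P Z f → InAM mu M Z)
    (hjoint : ∀ (W : C) (g : W ⟶ Y), (∀ Z f, P Z f → g ≫ f = 0) → g = 0) : InAM mu M Y := by
  rintro D E hD ⟨i⟩
  have hinj : Mono ((biprod.inl : D ⟶ D ⊞ E) ≫ i.inv) := mono_comp _ _
  obtain ⟨D', g, ⟨Z, f, hf, s, p, hD', hsp, -⟩, hg⟩ := gabriel_main hlen hmu _ D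
    (Nat.lt_succ_self _) hD
    (fun D' g => ∃ (Z : C) (f : Y ⟶ Z), P Z f ∧ ∃ (s : D' ⟶ Z) (p : Z ⟶ D'),
      Indecomposable D' ∧ s ≫ p = 𝟙 D' ∧ g = ((biprod.inl : D ⟶ D ⊞ E) ≫ i.inv) ≫ f ≫ p)
    (by rintro D' g ⟨Z, f, hf, s, p, hD', hsp, -⟩; exact hD')
    (by
      intro W g hg
      rw [← cancel_mono ((biprod.inl : D ⟶ D ⊞ E) ≫ i.inv), zero_comp]
      apply hjoint
      intro Z f hf
      by_contra hne
      obtain ⟨D', s, p, hD', hsp, hp⟩ := exists_indecomposable_retract hlen _ Z le_rfl _ hne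
      apply hp
      have := hg D' _ ⟨Z, f, hf, s, p, hD', hsp, rfl⟩
      simpa using this)
  have hmem : mu D' ∈ M := hP Z f hf D' _ hD' (retract_iso_biprod s p hsp)
  refine hM D D' hD hD' ?_ hmem
  rcases hg with hiso | hlt
  · exact mu_le_of_mono hlen hmu hD hD' g
  · exact lexLE_of_lexW hlt

/-- (Ringel) Let `M` be a set of values of the Gabriel-Roiter measure which
is closed under predecessors. Then the subcategory `A(M)` of objects all of
whose indecomposable direct summands have measure in `M` is covariantly
finite. -/
theorem grMeasure_closed_values_covariantlyFinite
    (len : C → ℕ) (hlen : ∀ Z : C, ObjLength Z (len Z))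
    (mu : C → Finset ℕ) (hmu : IsGRMeasure len mu)
    (M : Set (Finset ℕ))
    (hM : ∀ X Y : C, Indecomposable X → Indecomposable Y →
      lexLE (mu X) (mu Y) → mu Y ∈ M → mu X ∈ M) :
    ∀ X : C, ∃ (Y : C) (φ : X ⟶ Y),
      (∀ (D E : C), Indecomposable D → Nonempty (Y ≅ D ⊞ E) → mu D ∈ M) ∧
      ∀ (Z : C) (ψ : X ⟶ Z),
        (∀ (D E : C), Indecomposable D → Nonempty (Z ≅ D ⊞ E) → mu D ∈ M) →
        ∃ ρ : Y ⟶ Z, φ ≫ ρ = ψ := by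

  intro X
  classical
  -- choose a map to an object of `A(M)` whose kernel has minimal length
  have hne : ∃ n : ℕ, ∃ (Z : C) (f : X ⟶ Z), InAM mu M Z ∧ len (kernel f) = n := by
    obtain ⟨O, hO⟩ := HasZeroObject.zero (C := C)
    refine ⟨_, O, 0, ?_, rfl⟩
    refine inAM_of_joint hlen hmu hM O (fun _ _ => False) (fun _ _ h => h.elim) ?_
    intro W g _
    exact hO.eq_of_tgt _ _
  obtain ⟨Z₀, f₀, hZ₀, hk⟩ := Nat.find_spec hne
  refine ⟨Abelian.coimage f₀, Abelian.coimage.π f₀, ?_, ?_⟩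
  · refine inAM_of_joint hlen hmu hM _
      (fun Z f => ∃ h : Z₀ = Z, f = Abelian.factorThruCoimage f₀ ≫ eqToHom h) ?_ ?_
    · rintro Z f ⟨rfl, -⟩
      exact hZ₀
    · intro W g hg
      have := hg Z₀ _ ⟨rfl, rfl⟩
      rw [eqToHom_refl, Category.comp_id] at this
      rw [← cancel_mono (Abelian.factorThruCoimage f₀), this, zero_comp]
  · intro Z ψ hZ
    have hZ' : InAM mu M Z := hZ
    have hsum : InAM mu M (Z₀ ⊞ Z) := by
      refine inAM_of_joint hlen hmu hM _
        (fun T f => (∃ h : Z₀ = T, f = biprod.fst ≫ eqToHom h) ∨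
          (∃ h : Z = T, f = biprod.snd ≫ eqToHom h)) ?_ ?_
      · rintro T f (⟨rfl, -⟩ | ⟨rfl, -⟩)
        · exact hZ₀
        · exact hZ'
      · intro W g hg
        have h1 := hg Z₀ _ (Or.inl ⟨rfl, rfl⟩)
        have h2 := hg Z _ (Or.inr ⟨rfl, rfl⟩)
        rw [eqToHom_refl, Category.comp_id] at h1 h2
        ext
        · simpa using h1
        · simpa using h2
    have hmin := Nat.find_min' hne ⟨Z₀ ⊞ Z, biprod.lift f₀ ψ, hsum, rfl⟩
    rw [← hk] at hmin
    have hc := kernel.condition (biprod.lift f₀ ψ)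
    have h1 : kernel.ι (biprod.lift f₀ ψ) ≫ f₀ = 0 := by
      have := congrArg (fun k => k ≫ (biprod.fst : Z₀ ⊞ Z ⟶ _)) hc
      simpa only [Category.assoc, biprod.lift_fst, zero_comp] using this
    have h2 : kernel.ι (biprod.lift f₀ ψ) ≫ ψ = 0 := by
      have := congrArg (fun k => k ≫ (biprod.snd : Z₀ ⊞ Z ⟶ _)) hc
      simpa only [Category.assoc, biprod.lift_snd, zero_comp] using this
    have hiso : IsIso (kernel.lift f₀ (kernel.ι (biprod.lift f₀ ψ)) h1) := by
      by_contra hni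
      have := len_lt_of_mono hlen _ hni
      omega
    have h3 : kernel.ι f₀ ≫ ψ = 0 := by
      rw [← cancel_epi (kernel.lift f₀ (kernel.ι (biprod.lift f₀ ψ)) h1), comp_zero,
        kernel.lift_ι_assoc, h2]
    exact ⟨cokernel.desc _ ψ h3, cokernel.π_desc _ _ _⟩
end
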